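/- arXiv:2211.01157 — 2 statements merged into one kernel-verified Lean document; each statement's English description precedes it below -/
import Mathlib

section
/- Let K ∈ L¹(ℝ) satisfy the conservativeness conditions, assume t ↦ t²K(t) belongs to L¹(ℝ), and assume ν₁(K) = 0. Then the function λ ↦ ((λ + i)/λ)²·a_K(λ), defined for λ ≠ 0, extends to a continuous function b : ℝ → ℂ with b(0) = −ν₂(K)/2; moreover b(λ) ≠ 0 for every λ ∈ ℝ and b(λ) → 1 as λ → +∞ and as λ → −∞. -/
open MeasureTheory Filter Topology

/-- The symbol of the convolution operator with kernel `K`: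
`a_K(lam) = 1 - ∫ e^{i lam t} K(t) dt`. -/
noncomputable def symbolA (K : ℝ → ℝ) (lam : ℝ) : ℂ :=
  1 - ∫ t : ℝ, Complex.exp (Complex.I * lam * t) * (K t : ℂ)

/-- The `m`-th moment `ν_m(K) = ∫ t^m K(t) dt`. -/
noncomputable def moment (m : ℕ) (K : ℝ → ℝ) : ℝ :=
  ∫ t : ℝ, t ^ m * K t

/-- The normalized second order Taylor remainder of `x ↦ e^{ix}`, so that
`x² * expRemainder x = 1 + i x - e^{ix}`. -/
noncomputable def expRemainder (x : ℝ) : ℂ :=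
  ∫ s in (0 : ℝ)..1, (1 - (s : ℂ)) * Complex.exp (Complex.I * x * s)

theorem continuous_expRemainder : Continuous expRemainder := by
  unfold expRemainder
  apply intervalIntegral.continuous_parametric_intervalIntegral_of_continuous'
  fun_prop

theorem norm_expRemainder_le (x : ℝ) : ‖expRemainder x‖ ≤ 1 := by
  have h : ‖expRemainder x‖ ≤ 1 * |(1 : ℝ) - 0| := by
    apply intervalIntegral.norm_integral_le_of_norm_le_const
    intro s hs
    rw [Set.uIoc_of_le zero_le_one] at hs
    have h1 : ‖Complex.exp (Complex.I * x * s)‖ = 1 := by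
      rw [Complex.norm_exp]; simp
    rw [norm_mul, h1, mul_one, ← Complex.ofReal_one, ← Complex.ofReal_sub, Complex.norm_real,
      Real.norm_eq_abs, abs_le]
    constructor <;> linarith [hs.1, hs.2]
  simpa using h

theorem sq_mul_expRemainder (x : ℝ) :
    (x : ℂ) ^ 2 * expRemainder x = 1 + Complex.I * x - Complex.exp (Complex.I * x) := by
  have hd : ∀ s : ℝ, HasDerivAt
      (fun s : ℝ => -(Complex.I * x * (1 - (s : ℂ)) + 1) * Complex.exp (Complex.I * x * s))
      ((x : ℂ) ^ 2 * ((1 - (s : ℂ)) * Complex.exp (Complex.I * x * s))) s := by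
    intro s
    have h0 : HasDerivAt (fun s : ℝ => (s : ℂ)) 1 s := Complex.ofRealCLM.hasDerivAt
    have h1 := ((((h0.const_sub 1).const_mul (Complex.I * x)).add_const 1).neg).mul
      ((h0.const_mul (Complex.I * x)).cexp)
    refine h1.congr_deriv ?_
    simp only [Pi.neg_apply]
    linear_combination (-((x : ℂ) ^ 2 * (1 - (s : ℂ)) * Complex.exp (Complex.I * x * s))) *
      Complex.I_sq
  have h := intervalIntegral.integral_eq_sub_of_hasDerivAt (a := 0) (b := 1)
    (fun s _ => hd s) (by apply Continuous.intervalIntegrable; fun_prop)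
  rw [intervalIntegral.integral_const_mul] at h
  rw [expRemainder, h]
  simp
  ring

theorem expRemainder_zero : expRemainder 0 = 1 / 2 := by
  have h : ∫ s in (0 : ℝ)..1, (1 - (s : ℂ)) = ((∫ s in (0 : ℝ)..1, (1 - s) : ℝ) : ℂ) := by
    rw [← intervalIntegral.integral_ofReal]
    simp
  have h2 : ∫ s in (0 : ℝ)..1, (1 - s) = 1 / 2 := by
    rw [intervalIntegral.integral_sub (by simp) (by simp)]
    simp
    norm_num
  simp [expRemainder, h, h2]

theorem integrable_exp_mul {K : ℝ → ℝ} (hK : Integrable K) (lam : ℝ) :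
    Integrable (fun t : ℝ => Complex.exp (Complex.I * lam * t) * (K t : ℂ)) := by
  refine hK.ofReal.bdd_mul (c := 1) (Continuous.aestronglyMeasurable (by fun_prop)) ?_
  refine Eventually.of_forall fun t => ?_
  rw [Complex.norm_exp]
  simp

theorem integrable_id_mul {K : ℝ → ℝ} (hK : Integrable K)
    (hK2 : Integrable (fun t : ℝ => t ^ 2 * K t)) : Integrable (fun t : ℝ => t * K t) := by
  refine (hK.norm.add hK2.norm).mono
    (continuous_id.aestronglyMeasurable.mul hK.aestronglyMeasurable) ?_
  refine Eventually.of_forall fun t => ?_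
  have h : 0 ≤ ‖K t‖ + ‖t ^ 2 * K t‖ := by positivity
  rw [Pi.add_apply, Real.norm_of_nonneg h, norm_mul, norm_mul, norm_pow]
  nlinarith [norm_nonneg (K t), mul_nonneg (sq_nonneg (‖t‖ - 1)) (norm_nonneg (K t)),
    mul_nonneg (sq_nonneg ‖t‖) (norm_nonneg (K t))]

theorem symbolA_eq_sq_mul_integral {K : ℝ → ℝ} (hK : Integrable K) (hν0 : moment 0 K = 1)
    (hK2 : Integrable (fun t : ℝ => t ^ 2 * K t)) (hν1 : moment 1 K = 0) (lam : ℝ) :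
    symbolA K lam
      = (lam : ℂ) ^ 2 * ∫ t : ℝ, expRemainder (lam * t) * ((t ^ 2 * K t : ℝ) : ℂ) := by
  have h0 : ∫ t : ℝ, (K t : ℂ) = 1 := by
    rw [integral_complex_ofReal]
    simpa [moment] using hν0
  have h1 : ∫ t : ℝ, ((t * K t : ℝ) : ℂ) = 0 := by
    rw [integral_complex_ofReal]
    simpa [moment] using hν1
  have hi1 := (integrable_id_mul hK hK2).ofReal (𝕜 := ℂ)
  have e : ∀ t : ℝ, (lam : ℂ) ^ 2 * (expRemainder (lam * t) * ((t ^ 2 * K t : ℝ) : ℂ))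
      = (K t : ℂ) + Complex.I * lam * ((t * K t : ℝ) : ℂ)
        - Complex.exp (Complex.I * lam * t) * (K t : ℂ) := by
    intro t
    have := sq_mul_expRemainder (lam * t)
    push_cast at this ⊢
    rw [← mul_assoc] at this
    linear_combination (K t : ℂ) * this
  have hi0 : Integrable (fun t : ℝ => (K t : ℂ)) := hK.ofReal
  have hi2 : Integrable (fun t : ℝ => Complex.I * lam * ((t * K t : ℝ) : ℂ)) := hi1.const_mul _
  have hi3 : Integrable (fun t : ℝ => (K t : ℂ) + Complex.I * lam * ((t * K t : ℝ) : ℂ)) :=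
    hi0.add hi2
  rw [← integral_const_mul]
  simp_rw [e]
  rw [integral_sub hi3 (integrable_exp_mul hK lam), integral_add hi0 hi2, integral_const_mul,
    h0, h1, mul_zero, add_zero, symbolA]

theorem continuous_integral_expRemainder_mul {f : ℝ → ℝ} (hf : Integrable f) :
    Continuous (fun lam : ℝ => ∫ t : ℝ, expRemainder (lam * t) * (f t : ℂ)) := by
  refine continuous_of_dominated (bound := fun t => ‖f t‖) ?_ ?_ hf.norm ?_
  · intro lam
    exact (continuous_expRemainder.comp (continuous_const.mul continuous_id)).aestronglyMeasurable.mul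
      hf.ofReal.aestronglyMeasurable
  · refine fun lam => Eventually.of_forall fun t => ?_
    rw [norm_mul, Complex.norm_real]
    exact mul_le_of_le_one_left (norm_nonneg _) (norm_expRemainder_le _)
  · refine Eventually.of_forall fun t => ?_
    exact (continuous_expRemainder.comp (continuous_id.mul continuous_const)).mul continuous_const

/-- A nonnegative function whose integral against a weight positive off a countable set vanishes
is almost everywhere zero. -/
theorem ae_eq_zero_of_integral_mul_eq_zero {K w : ℝ → ℝ} (hKpos : ∀ᵐ t : ℝ, 0 ≤ K t)
    (hw : ∀ t, 0 ≤ w t) (hwc : {t | w t = 0}.Countable) (hi : Integrable (fun t => w t * K t))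
    (h : ∫ t : ℝ, w t * K t = 0) : K =ᵐ[volume] 0 := by
  have hz := (integral_eq_zero_iff_of_nonneg_ae
    (hKpos.mono fun t ht => mul_nonneg (hw t) ht) hi).1 h
  filter_upwards [hz, hwc.ae_notMem volume] with t ht htw
  exact (mul_eq_zero.1 ht).resolve_left htw

theorem not_ae_eq_zero_of_moment_zero {K : ℝ → ℝ} (hν0 : moment 0 K = 1) :
    ¬ K =ᵐ[volume] 0 := by
  intro h
  have : ∫ t : ℝ, K t = 0 := integral_eq_zero_of_ae h
  simp [moment, this] at hν0

theorem moment_two_ne_zero {K : ℝ → ℝ} (hKpos : ∀ᵐ t : ℝ, 0 ≤ K t) (hν0 : moment 0 K = 1)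
    (hK2 : Integrable (fun t : ℝ => t ^ 2 * K t)) : moment 2 K ≠ 0 := by
  intro h
  refine not_ae_eq_zero_of_moment_zero hν0
    (ae_eq_zero_of_integral_mul_eq_zero hKpos (fun t => sq_nonneg t) ?_ hK2 h)
  simp

theorem countable_setOf_one_sub_cos_eq_zero {lam : ℝ} (hl : lam ≠ 0) :
    {t : ℝ | 1 - Real.cos (lam * t) = 0}.Countable := by
  refine (Set.countable_range (fun n : ℤ => (n * (2 * Real.pi)) / lam)).mono ?_
  intro t ht
  obtain ⟨n, hn⟩ := (Real.cos_eq_one_iff _).1 (sub_eq_zero.1 ht).symm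
  refine ⟨n, ?_⟩
  simp only [hn]
  field_simp

theorem symbolA_ne_zero {K : ℝ → ℝ} (hK : Integrable K) (hKpos : ∀ᵐ t : ℝ, 0 ≤ K t)
    (hν0 : moment 0 K = 1) {lam : ℝ} (hl : lam ≠ 0) : symbolA K lam ≠ 0 := by
  intro h
  have hE := integrable_exp_mul hK lam
  have hre : ∀ t : ℝ, (Complex.exp (Complex.I * lam * t) * (K t : ℂ)).re
      = Real.cos (lam * t) * K t := by
    intro t
    rw [Complex.re_mul_ofReal, Complex.exp_re]
    simp
  have hcos : Integrable (fun t : ℝ => Real.cos (lam * t) * K t) := by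
    simpa only [RCLike.re_to_complex, hre] using hE.re
  have h1 : ∫ t : ℝ, Real.cos (lam * t) * K t = 1 := by
    have h2 : ∫ t : ℝ, Complex.exp (Complex.I * lam * t) * (K t : ℂ) = 1 :=
      (sub_eq_zero.1 h).symm
    have h3 := integral_re hE
    simp only [RCLike.re_to_complex, hre, h2] at h3
    simpa using h3
  have h0 : ∫ t : ℝ, K t = 1 := by simpa [moment] using hν0
  have e : (fun t : ℝ => (1 - Real.cos (lam * t)) * K t)
      = fun t => K t - Real.cos (lam * t) * K t := by
    ext t; ring
  refine not_ae_eq_zero_of_moment_zero hν0 (ae_eq_zero_of_integral_mul_eq_zero hKpos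
    (fun t => sub_nonneg.2 (Real.cos_le_one (lam * t)))
    (countable_setOf_one_sub_cos_eq_zero hl) ?_ ?_)
  · rw [e]
    exact hK.sub hcos
  · rw [e, integral_sub hK hcos, h0, h1, sub_self]

theorem tendsto_symbolA_cocompact (K : ℝ → ℝ) :
    Tendsto (symbolA K) (cocompact ℝ) (𝓝 1) := by
  have h := Real.tendsto_integral_exp_smul_cocompact (fun t => (K t : ℂ))
  have hc : (-(2 * Real.pi)⁻¹ : ℝ) ≠ 0 := by
    have := Real.pi_pos
    simp [this.ne']
  have hm := (Homeomorph.mulLeft₀ _ hc).isClosedEmbedding.tendsto_cocompact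
  have h2 := (h.comp hm).const_sub 1
  rw [sub_zero] at h2
  refine h2.congr fun lam => ?_
  simp only [Function.comp, symbolA, Homeomorph.coe_mulLeft₀]
  congr 2
  ext t
  rw [Circle.smul_def, Real.fourierChar_apply, smul_eq_mul]
  congr 2
  push_cast
  have : (Real.pi : ℂ) ≠ 0 := by exact_mod_cast Real.pi_ne_zero
  field_simp

theorem tendsto_add_I_div_sq_mul_symbolA (K : ℝ → ℝ) :
    Tendsto (fun lam : ℝ => (((lam : ℂ) + Complex.I) / (lam : ℂ)) ^ 2 * symbolA K lam)
      (cocompact ℝ) (𝓝 1) := by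
  have hinv : Tendsto (fun lam : ℝ => ((lam⁻¹ : ℝ) : ℂ)) (cocompact ℝ) (𝓝 0) := by
    have := (Complex.continuous_ofReal.tendsto 0).comp (tendsto_inv₀_cobounded (α := ℝ))
    rw [Metric.cobounded_eq_cocompact] at this
    rwa [Complex.ofReal_zero] at this
  have h := (((hinv.const_mul Complex.I).const_add 1).pow 2).mul (tendsto_symbolA_cocompact K)
  simp only [mul_zero, add_zero, one_pow, mul_one] at h
  refine h.congr' ?_
  have hne : ∀ᶠ lam : ℝ in cocompact ℝ, lam ≠ 0 :=
    isCompact_singleton.compl_mem_cocompact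
  filter_upwards [hne] with lam hl
  have : (lam : ℂ) ≠ 0 := by exact_mod_cast hl
  push_cast
  field_simp

theorem stmt7 (K : ℝ → ℝ) (hK : Integrable K)
    (hKpos : ∀ᵐ t : ℝ, 0 ≤ K t) (hν0 : moment 0 K = 1)
    (hK2 : Integrable (fun t : ℝ => t ^ 2 * K t)) (hν1 : moment 1 K = 0) :
    ∃ b : ℝ → ℂ, Continuous b ∧
      (∀ lam : ℝ, lam ≠ 0 →
        b lam = (((lam : ℂ) + Complex.I) / (lam : ℂ)) ^ 2 * symbolA K lam) ∧
      b 0 = -(moment 2 K : ℂ) / 2 ∧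
      (∀ lam : ℝ, b lam ≠ 0) ∧
      Tendsto b atTop (𝓝 1) ∧ Tendsto b atBot (𝓝 1) := by
  obtain ⟨b, hb⟩ : ∃ b : ℝ → ℂ, b = fun lam : ℝ => ((lam : ℂ) + Complex.I) ^ 2 *
    ∫ t : ℝ, expRemainder (lam * t) * ((t ^ 2 * K t : ℝ) : ℂ) := ⟨_, rfl⟩
  have hbc : Continuous b := by
    rw [hb]
    exact ((Complex.continuous_ofReal.add continuous_const).pow 2).mul
      (continuous_integral_expRemainder_mul hK2)
  have hbs : ∀ lam : ℝ, lam ≠ 0 →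
      b lam = (((lam : ℂ) + Complex.I) / (lam : ℂ)) ^ 2 * symbolA K lam := by
    intro lam hl
    have : (lam : ℂ) ≠ 0 := by exact_mod_cast hl
    rw [symbolA_eq_sq_mul_integral hK hν0 hK2 hν1, hb]
    field_simp
  have hb0 : b 0 = -(moment 2 K : ℂ) / 2 := by
    simp only [hb, zero_mul, expRemainder_zero]
    rw [integral_const_mul, integral_complex_ofReal, Complex.ofReal_zero, zero_add,
      Complex.I_sq, moment]
    ring
  have hbt : Tendsto b (cocompact ℝ) (𝓝 1) := by
    refine (tendsto_add_I_div_sq_mul_symbolA K).congr' ?_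
    have hne : ∀ᶠ lam : ℝ in cocompact ℝ, lam ≠ 0 :=
      isCompact_singleton.compl_mem_cocompact
    filter_upwards [hne] with lam hl
    exact (hbs lam hl).symm
  refine ⟨b, hbc, hbs, hb0, fun lam => ?_, hbt.mono_left atTop_le_cocompact,
    hbt.mono_left atBot_le_cocompact⟩
  rcases eq_or_ne lam 0 with rfl | hl
  · rw [hb0]
    have : (moment 2 K : ℂ) ≠ 0 := by exact_mod_cast moment_two_ne_zero hKpos hν0 hK2
    exact div_ne_zero (neg_ne_zero.2 this) two_ne_zero
  · rw [hbs lam hl]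
    refine mul_ne_zero (pow_ne_zero _ (div_ne_zero ?_ (by exact_mod_cast hl)))
      (symbolA_ne_zero hK hKpos hν0 hl)
    intro h
    simpa using congrArg Complex.im h
end

section
/- Let K ∈ L¹(ℝ) satisfy the conservativeness conditions, assume t ↦ t²K(t) belongs to L¹(ℝ), and assume ν₁(K) = 0. Let b : ℝ → ℂ be the continuous extension of λ ↦ ((λ + i)/λ)²·a_K(λ) (with b(0) = −ν₂(K)/2). Then b belongs to the Wiener algebra: there exists g ∈ L¹(ℝ, ℂ) such that b(λ) = 1 + ∫_ℝ e^{iλt} g(t) dt for all λ ∈ ℝ. -/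
open MeasureTheory Filter Topology

/-- The signed indicator of the oriented interval from `0` to `s`, as a function of `t`. -/
noncomputable def orientedIndicator (s t : ℝ) : ℝ :=
  (Set.Ioc 0 s).indicator 1 t - (Set.Ioc s 0).indicator 1 t

lemma measurable_orientedIndicator :
    Measurable fun p : ℝ × ℝ => orientedIndicator p.1 p.2 := by
  have h₁ : MeasurableSet {p : ℝ × ℝ | p.2 ∈ Set.Ioc 0 p.1} :=
    (measurableSet_lt measurable_const measurable_snd).inter
      (measurableSet_le measurable_snd measurable_fst)
  have h₂ : MeasurableSet {p : ℝ × ℝ | p.2 ∈ Set.Ioc p.1 0} :=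
    (measurableSet_lt measurable_fst measurable_snd).inter
      (measurableSet_le measurable_snd measurable_const)
  exact ((measurable_const (a := (1 : ℝ))).indicator h₁).sub
    ((measurable_const (a := (1 : ℝ))).indicator h₂)

lemma integral_mul_orientedIndicator {f : ℝ → ℂ} (hf : Continuous f) (s : ℝ) :
    ∫ t, f t * (orientedIndicator s t : ℂ) = ∫ t in (0 : ℝ)..s, f t := by
  have key : ∀ t, f t * (orientedIndicator s t : ℂ) =
      (Set.Ioc 0 s).indicator f t - (Set.Ioc s 0).indicator f t := by
    intro t
    by_cases h₁ : t ∈ Set.Ioc 0 s <;> by_cases h₂ : t ∈ Set.Ioc s 0 <;>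
      simp [orientedIndicator, h₁, h₂]
  have hi : ∀ a b : ℝ, Integrable ((Set.Ioc a b).indicator f) := fun a b =>
    (hf.integrableOn_Ioc).integrable_indicator measurableSet_Ioc
  simp_rw [key]
  rw [integral_sub (hi _ _) (hi _ _), integral_indicator measurableSet_Ioc,
    integral_indicator measurableSet_Ioc, intervalIntegral]

lemma abs_orientedIndicator_le (s t : ℝ) :
    |orientedIndicator s t| ≤ (Set.Icc (-|s|) |s|).indicator 1 t := by
  have hs := neg_abs_le s
  have hs' := le_abs_self s
  have h0 := abs_nonneg s
  by_cases h₁ : t ∈ Set.Ioc 0 s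
  · have h₂ : t ∉ Set.Ioc s 0 := fun h => by linarith [h.2, h₁.1]
    have h₃ : t ∈ Set.Icc (-|s|) |s| := ⟨by linarith [h₁.1], by linarith [h₁.2]⟩
    simp [orientedIndicator, h₁, h₂, h₃]
  by_cases h₂ : t ∈ Set.Ioc s 0
  · have h₃ : t ∈ Set.Icc (-|s|) |s| := ⟨by linarith [h₂.1], by linarith [h₂.2]⟩
    simp [orientedIndicator, h₁, h₂, h₃]
  · simp only [orientedIndicator, h₁, h₂, not_false_eq_true, Set.indicator_of_notMem, sub_zero,
      abs_zero]
    exact Set.indicator_nonneg (fun _ _ => zero_le_one) t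

lemma integrable_mul_indicator_Icc_abs {f : ℝ → ℝ} (hf : AEStronglyMeasurable f)
    (hf' : Integrable fun s => |s| * |f s|) :
    Integrable (fun p : ℝ × ℝ => f p.1 * (Set.Icc (-|p.1|) |p.1|).indicator 1 p.2)
      (volume.prod volume) := by
  have hS : MeasurableSet {p : ℝ × ℝ | p.2 ∈ Set.Icc (-|p.1|) |p.1|} :=
    (measurableSet_le (by fun_prop) measurable_snd).inter
      (measurableSet_le measurable_snd (by fun_prop))
  have hm : Measurable fun p : ℝ × ℝ => (Set.Icc (-|p.1|) |p.1|).indicator (1 : ℝ → ℝ) p.2 :=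
    (measurable_const (a := (1 : ℝ))).indicator hS
  have hi : ∀ s : ℝ, Integrable ((Set.Icc (-|s|) |s|).indicator (1 : ℝ → ℝ)) := fun s =>
    (continuous_one.integrableOn_Icc).integrable_indicator measurableSet_Icc
  refine (integrable_prod_iff (hf.comp_fst.mul hm.aestronglyMeasurable)).2 ⟨.of_forall fun s => (hi s).const_mul (f s), ?_⟩
  refine (hf'.const_mul 2).congr (.of_forall fun s => ?_)
  have hn : ∀ t, ‖f s * (Set.Icc (-|s|) |s|).indicator (1 : ℝ → ℝ) t‖ =
      |f s| * (Set.Icc (-|s|) |s|).indicator (1 : ℝ → ℝ) t := fun t => by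
    rw [norm_mul, Real.norm_eq_abs, Real.norm_of_nonneg
      (Set.indicator_nonneg (f := (1 : ℝ → ℝ)) (fun _ _ => zero_le_one) t)]
  simp only [Pi.mul_apply, hn]
  rw [integral_const_mul, integral_indicator_one measurableSet_Icc, Real.volume_real_Icc_of_le
    (by linarith [abs_nonneg s])]
  ring

/-- The kernel `(2 - s + t) K(s)` on the oriented interval from `0` to `s`; integrated in `s` it
yields the density of `((lam + i) / lam)² a_K(lam) - a_K(lam)`. -/
noncomputable def tailKernel (K : ℝ → ℝ) (s t : ℝ) : ℝ :=
  (2 - s + t) * orientedIndicator s t * K s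

lemma integrable_tailKernel {K : ℝ → ℝ} (hK : Integrable K)
    (hK2 : Integrable fun t : ℝ => t ^ 2 * K t) (hK1 : Integrable fun t : ℝ => t * K t) :
    Integrable (fun p : ℝ × ℝ => tailKernel K p.1 p.2) (volume.prod volume) := by
  have hm : AEStronglyMeasurable (fun s : ℝ => (2 + 2 * |s|) * |K s|) :=
    AEStronglyMeasurable.mul (Continuous.aestronglyMeasurable (by fun_prop))
      hK.aestronglyMeasurable.norm
  have hint : Integrable fun s : ℝ => |s| * abs ((2 + 2 * |s|) * |K s|) := by
    refine ((hK1.norm.const_mul 2).add (hK2.norm.const_mul 2)).congr (.of_forall fun s => ?_)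
    have : 0 ≤ (2 + 2 * |s|) * |K s| := by positivity
    simp only [Pi.add_apply, norm_mul, Real.norm_eq_abs, abs_of_nonneg this, abs_pow]
    ring
  refine (integrable_mul_indicator_Icc_abs hm hint).mono' ?_ (.of_forall fun p => ?_)
  · refine AEStronglyMeasurable.mul (Measurable.aestronglyMeasurable ?_)
      hK.aestronglyMeasurable.comp_fst
    exact Measurable.mul (by fun_prop) measurable_orientedIndicator
  · obtain ⟨s, t⟩ := p
    have h := abs_orientedIndicator_le s t
    simp only [tailKernel, norm_mul, Real.norm_eq_abs]
    by_cases ht : t ∈ Set.Icc (-|s|) |s|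
    · rw [Set.indicator_of_mem ht, Pi.one_apply] at h ⊢
      have h₁ : |2 - s + t| ≤ 2 + 2 * |s| := by
        rw [abs_le]
        constructor <;> linarith [ht.1, ht.2, neg_abs_le s, le_abs_self s]
      calc |2 - s + t| * |orientedIndicator s t| * |K s| ≤ (2 + 2 * |s|) * 1 * |K s| := by gcongr
        _ = _ := by ring
    · rw [Set.indicator_of_notMem ht] at h ⊢
      rw [le_antisymm h (abs_nonneg _)]
      simp

lemma continuous_exp_I_mul (lam : ℝ) :
    Continuous fun t : ℝ => Complex.exp (Complex.I * lam * t) := by fun_prop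

lemma norm_exp_I_mul (lam t : ℝ) : ‖Complex.exp (Complex.I * lam * t)‖ = 1 := by
  rw [show Complex.I * lam * t = ((lam * t : ℝ) : ℂ) * Complex.I by push_cast; ring]
  exact Complex.norm_exp_ofReal_mul_I _

lemma MeasureTheory.Integrable.exp_I_mul {α : Type*} [MeasurableSpace α] {μ : Measure α}
    {f : α → ℂ} (hf : Integrable f μ) (lam : ℝ) {u : α → ℝ} (hu : Measurable u) :
    Integrable (fun x => Complex.exp (Complex.I * lam * u x) * f x) μ :=
  hf.bdd_mul (c := 1) ((continuous_exp_I_mul lam).measurable.comp hu).aestronglyMeasurable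
    (.of_forall fun x => (norm_exp_I_mul lam (u x)).le)

lemma integral_exp_mul_integral_tailKernel {K : ℝ → ℝ}
    (h : Integrable (fun p : ℝ × ℝ => tailKernel K p.1 p.2) (volume.prod volume)) (lam : ℝ) :
    ∫ t : ℝ, Complex.exp (Complex.I * lam * t) * ∫ s : ℝ, (tailKernel K s t : ℂ) =
      ∫ s : ℝ, (∫ t in (0 : ℝ)..s, Complex.exp (Complex.I * lam * t) * (2 - s + t)) * (K s : ℂ) := by
  have h' := Integrable.exp_I_mul (h.ofReal (𝕜 := ℂ)) lam measurable_snd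
  simp_rw [← integral_const_mul]
  rw [← integral_integral_swap
    (f := fun s t : ℝ => Complex.exp (Complex.I * lam * t) * (tailKernel K s t : ℂ)) h']
  congr 1 with s
  rw [← integral_mul_orientedIndicator (by fun_prop), ← integral_mul_const]
  congr 1 with t
  simp only [tailKernel]
  push_cast
  ring

lemma intervalIntegral_exp_mul_affine {lam : ℝ} (hl : lam ≠ 0) (s : ℝ) :
    ∫ t in (0 : ℝ)..s, Complex.exp (Complex.I * lam * t) * (2 - s + t) =
      (Complex.exp (Complex.I * lam * s) - 1) *
        (2 / (Complex.I * lam) - 1 / (Complex.I * lam) ^ 2) + s / (Complex.I * lam) := by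
  have hc : Complex.I * lam ≠ 0 := mul_ne_zero Complex.I_ne_zero (by exact_mod_cast hl)
  set c : ℂ := Complex.I * lam
  have hd : ∀ t : ℝ, HasDerivAt
      (fun t : ℝ => Complex.exp (c * t) * ((2 - s + t) / c - 1 / c ^ 2))
      (Complex.exp (c * t) * (2 - s + t)) t := by
    intro t
    have hid : HasDerivAt (fun t : ℝ => (t : ℂ)) 1 t := Complex.ofRealCLM.hasDerivAt
    have h₁ := (hid.const_mul c).cexp
    have h₂ := ((hid.const_add (2 - (s : ℂ))).div_const c).sub_const (1 / c ^ 2)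
    refine (h₁.mul h₂).congr_deriv ?_
    field_simp
    ring
  rw [intervalIntegral.integral_eq_sub_of_hasDerivAt (fun t _ => hd t)
    (Continuous.intervalIntegrable (by fun_prop) _ _)]
  simp only [Complex.ofReal_zero, mul_zero, Complex.exp_zero]
  ring

lemma intervalIntegral_affine (s : ℝ) :
    ∫ t in (0 : ℝ)..s, ((2 : ℂ) - s + t) = 2 * s - s ^ 2 / 2 := by
  have hd : ∀ t : ℝ, HasDerivAt (fun t : ℝ => (2 - (s : ℂ)) * t + (t : ℂ) ^ 2 / 2)
      (2 - (s : ℂ) + t) t := by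
    intro t
    have hid : HasDerivAt (fun t : ℝ => (t : ℂ)) 1 t := Complex.ofRealCLM.hasDerivAt
    refine ((hid.const_mul (2 - (s : ℂ))).add ((hid.pow 2).div_const 2)).congr_deriv ?_
    push_cast
    ring
  rw [intervalIntegral.integral_eq_sub_of_hasDerivAt (fun t _ => hd t)
    (Continuous.intervalIntegrable (by fun_prop) _ _)]
  simp only [Complex.ofReal_zero]
  ring

theorem stmt8 (K : ℝ → ℝ) (hK : Integrable K)
    (hKpos : ∀ᵐ t : ℝ, 0 ≤ K t) (hν0 : moment 0 K = 1)
    (hK2 : Integrable (fun t : ℝ => t ^ 2 * K t)) (hν1 : moment 1 K = 0)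
    (b : ℝ → ℂ) (hb : Continuous b)
    (hbe : ∀ lam : ℝ, lam ≠ 0 →
      b lam = (((lam : ℂ) + Complex.I) / (lam : ℂ)) ^ 2 * symbolA K lam)
    (hb0 : b 0 = -(moment 2 K : ℂ) / 2) :
    ∃ g : ℝ → ℂ, Integrable g ∧
      ∀ lam : ℝ, b lam = 1 + ∫ t : ℝ, Complex.exp (Complex.I * lam * t) * g t := by
  have hK1 : Integrable fun t : ℝ => t * K t := by
    refine (hK.norm.add hK2.norm).mono'
      (continuous_id.aestronglyMeasurable.mul hK.aestronglyMeasurable) (.of_forall fun t => ?_)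
    simp only [Pi.add_apply, norm_mul, Real.norm_eq_abs, abs_pow]
    have : |t| ≤ 1 + |t| ^ 2 := by nlinarith [sq_nonneg (|t| - 1), abs_nonneg t]
    nlinarith [abs_nonneg (K t)]
  have hKc : Integrable fun t : ℝ => (K t : ℂ) := hK.ofReal
  have hK1c : Integrable fun t : ℝ => (t : ℂ) * (K t : ℂ) := by
    simpa using hK1.ofReal (𝕜 := ℂ)
  have hK2c : Integrable fun t : ℝ => (t : ℂ) ^ 2 * (K t : ℂ) := by
    simpa using hK2.ofReal (𝕜 := ℂ)
  have hν (m : ℕ) : ∫ t : ℝ, (t : ℂ) ^ m * (K t : ℂ) = (moment m K : ℂ) := by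
    rw [moment, ← integral_complex_ofReal]
    simp
  have h0 : ∫ t : ℝ, (K t : ℂ) = 1 := by simpa [hν0] using hν 0
  have h1 : ∫ t : ℝ, (t : ℂ) * (K t : ℂ) = 0 := by simpa [hν1] using hν 1
  have hT := integrable_tailKernel hK hK2 hK1
  have hG : Integrable fun t : ℝ => ∫ s : ℝ, (tailKernel K s t : ℂ) :=
    (hT.ofReal (𝕜 := ℂ)).integral_prod_right
  refine ⟨fun t => (∫ s : ℝ, (tailKernel K s t : ℂ)) - K t, hG.sub hKc, fun lam => ?_⟩
  have hE := hKc.exp_I_mul lam (u := fun t => t) measurable_id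
  simp_rw [mul_sub]
  rw [integral_sub (hG.exp_I_mul lam (u := fun t => t) measurable_id) hE,
    integral_exp_mul_integral_tailKernel hT]
  rcases eq_or_ne lam 0 with rfl | hl
  · simp only [Complex.ofReal_zero, mul_zero, zero_mul, Complex.exp_zero, one_mul,
      intervalIntegral_affine]
    have hr : ∀ s : ℝ, (2 * (s : ℂ) - (s : ℂ) ^ 2 / 2) * (K s : ℂ) =
        2 * ((s : ℂ) * K s) - 1 / 2 * ((s : ℂ) ^ 2 * K s) := fun s => by ring
    simp_rw [hr]
    rw [integral_sub (hK1c.const_mul _) (hK2c.const_mul _), integral_const_mul,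
      integral_const_mul, h0, h1, hν 2, hb0]
    ring
  · simp_rw [intervalIntegral_exp_mul_affine hl]
    have hl' : (lam : ℂ) ≠ 0 := by exact_mod_cast hl
    have hr : ∀ s : ℝ, ((Complex.exp (Complex.I * lam * s) - 1) *
        (2 / (Complex.I * lam) - 1 / (Complex.I * lam) ^ 2) + s / (Complex.I * lam)) * (K s : ℂ) =
        (2 / (Complex.I * lam) - 1 / (Complex.I * lam) ^ 2) *
          (Complex.exp (Complex.I * lam * s) * K s - K s) +
        1 / (Complex.I * lam) * (s * K s) := fun s => by ring
    simp_rw [hr]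
    have hEK : Integrable fun s : ℝ => Complex.exp (Complex.I * lam * s) * (K s : ℂ) - K s :=
      hE.sub hKc
    rw [integral_add (hEK.const_mul _) (hK1c.const_mul _), integral_const_mul,
      integral_const_mul, integral_sub hE hKc, h0, h1, hbe lam hl, symbolA]
    generalize (∫ t : ℝ, Complex.exp (Complex.I * lam * t) * (K t : ℂ)) = F
    have hI := Complex.I_sq
    field_simp
    simp only [hI]
    linear_combination (F - 1) * hI
end
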